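/- Let m > n and K ≥ 0, suppose (ℝ^n, φ) satisfies the CD(−K, m) condition with ∇φ and ∇²φ uniformly bounded on ℝ^n, and let u : [0,T] × ℝ^n → ℝ be a smooth positive solution of the heat equation ∂ₜu = Lu such that u, ∂ₜu, ∇u and ∇²u are bounded on [0,T] × ℝ^n, and set A := sup{ u(t,x) : (t,x) ∈ [0,T] × ℝ^n } < ∞. Then for all t ∈ (0, T] and x ∈ ℝ^n, ∂ₜu(t,x)/u(t,x) ≤ (K + 1/t) · [m + 4 log(A/u(t,x))]. (Euclidean case of inequality (2.9) in the paper's Theorem 2.3.) -/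

import Mathlib

open scoped RealInnerProductSpace

noncomputable section

/-- Hessian of `f` at `x`, evaluated at the pair of vectors `(v, w)`. -/
def hess (n : ℕ) (f : EuclideanSpace ℝ (Fin n) → ℝ) (x v w : EuclideanSpace ℝ (Fin n)) : ℝ :=
  fderiv ℝ (fun y => fderiv ℝ f y v) x w

/-- Laplacian `Δf = tr ∇²f`. -/
def lap (n : ℕ) (f : EuclideanSpace ℝ (Fin n) → ℝ) (x : EuclideanSpace ℝ (Fin n)) : ℝ :=
  ∑ i : Fin n, hess n f x (EuclideanSpace.single i 1) (EuclideanSpace.single i 1)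

/-- Witten Laplacian `Lf = Δf − ⟨∇φ, ∇f⟩`. -/
def witten (n : ℕ) (φ f : EuclideanSpace ℝ (Fin n) → ℝ) (x : EuclideanSpace ℝ (Fin n)) : ℝ :=
  lap n f x - ⟪gradient φ x, gradient f x⟫

/-- Squared Frobenius norm of the Hessian. -/
def hessNormSq (n : ℕ) (f : EuclideanSpace ℝ (Fin n) → ℝ) (x : EuclideanSpace ℝ (Fin n)) : ℝ :=
  ∑ i : Fin n, ∑ j : Fin n,
    (hess n f x (EuclideanSpace.single i 1) (EuclideanSpace.single j 1)) ^ 2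

/-- The `CD(−K, m)` condition on Euclidean space `ℝⁿ`:
`∇²φ(v,v) − ⟨∇φ, v⟩²/(m−n) ≥ −K|v|²` at every point and for every vector. -/
def CDcond (n : ℕ) (φ : EuclideanSpace ℝ (Fin n) → ℝ) (m K : ℝ) : Prop :=
  ∀ x v : EuclideanSpace ℝ (Fin n),
    hess n φ x v v - ⟪gradient φ x, v⟫ ^ 2 / (m - n) ≥ -K * ‖v‖ ^ 2

section DirectionalCalculus

open Topology Filter

variable {E ι : Type*} [NormedAddCommGroup E] [NormedSpace ℝ E] [Fintype ι]

/-- The derivative of `f` in the fixed direction `v`, as a function of the base point. -/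
def dirDeriv (v : E) (f : E → ℝ) (p : E) : ℝ := fderiv ℝ f p v

lemma dirDeriv_congr {v : E} {f g : E → ℝ} {Ω : Set E} (hΩ : IsOpen Ω)
    (h : ∀ p ∈ Ω, f p = g p) {p : E} (hp : p ∈ Ω) : dirDeriv v f p = dirDeriv v g p := by
  have : f =ᶠ[𝓝 p] g := by
    filter_upwards [hΩ.mem_nhds hp] with q hq using h q hq
  rw [dirDeriv, dirDeriv, this.fderiv_eq]

lemma contDiffOn_dirDeriv {v : E} {f : E → ℝ} {Ω : Set E} (hΩ : IsOpen Ω)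
    (hf : ContDiffOn ℝ (⊤ : ℕ∞) f Ω) : ContDiffOn ℝ (⊤ : ℕ∞) (dirDeriv v f) Ω :=
  (hf.fderiv_of_isOpen (m := (⊤ : ℕ∞)) hΩ le_rfl).clm_apply contDiffOn_const

lemma ContDiffOn.differentiableAt_of_isOpen {f : E → ℝ} {Ω : Set E}
    (hf : ContDiffOn ℝ (⊤ : ℕ∞) f Ω) (hΩ : IsOpen Ω) {p : E} (hp : p ∈ Ω) :
    DifferentiableAt ℝ f p :=
  (hf.contDiffAt (hΩ.mem_nhds hp)).differentiableAt (by simp)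

lemma dirDeriv_dirDeriv_eq {v w : E} {f : E → ℝ} {p : E}
    (h : DifferentiableAt ℝ (fderiv ℝ f) p) :
    dirDeriv v (dirDeriv w f) p = fderiv ℝ (fderiv ℝ f) p v w := by
  unfold dirDeriv
  rw [fderiv_clm_apply h (differentiableAt_const w)]
  simp

lemma dirDeriv_comm {v w : E} {f : E → ℝ} {Ω : Set E} (hΩ : IsOpen Ω)
    (hf : ContDiffOn ℝ (⊤ : ℕ∞) f Ω) {p : E} (hp : p ∈ Ω) :
    dirDeriv v (dirDeriv w f) p = dirDeriv w (dirDeriv v f) p := by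
  have hc := hf.contDiffAt (hΩ.mem_nhds hp)
  have hd : DifferentiableAt ℝ (fderiv ℝ f) p :=
    (hc.fderiv_right (m := (⊤ : ℕ∞)) le_rfl).differentiableAt (by simp)
  have hs : IsSymmSndFDerivAt ℝ f p :=
    hc.isSymmSndFDerivAt (by
      rw [minSmoothness_of_isRCLikeNormedField]
      exact WithTop.coe_le_coe.2 le_top)
  rw [dirDeriv_dirDeriv_eq hd, dirDeriv_dirDeriv_eq hd, hs v w]

lemma dirDeriv_mul {v : E} {f g : E → ℝ} {p : E} (hf : DifferentiableAt ℝ f p)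
    (hg : DifferentiableAt ℝ g p) :
    dirDeriv v (fun q => f q * g q) p = f p * dirDeriv v g p + g p * dirDeriv v f p := by
  simp [dirDeriv, fderiv_fun_mul hf hg]

lemma dirDeriv_add {v : E} {f g : E → ℝ} {p : E} (hf : DifferentiableAt ℝ f p)
    (hg : DifferentiableAt ℝ g p) :
    dirDeriv v (fun q => f q + g q) p = dirDeriv v f p + dirDeriv v g p := by
  simp [dirDeriv, fderiv_fun_add hf hg]

lemma dirDeriv_sub {v : E} {f g : E → ℝ} {p : E} (hf : DifferentiableAt ℝ f p)
    (hg : DifferentiableAt ℝ g p) :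
    dirDeriv v (fun q => f q - g q) p = dirDeriv v f p - dirDeriv v g p := by
  simp [dirDeriv, fderiv_fun_sub hf hg]

lemma dirDeriv_sum {κ : Type*} [Fintype κ] {v : E} {f : κ → E → ℝ} {p : E}
    (hf : ∀ k, DifferentiableAt ℝ (f k) p) :
    dirDeriv v (fun q => ∑ k, f k q) p = ∑ k, dirDeriv v (f k) p := by
  simp [dirDeriv, fderiv_fun_sum (fun k _ => hf k)]

lemma dirDeriv_const (v : E) (a : ℝ) (p : E) : dirDeriv v (fun _ => a) p = 0 := by
  simp [dirDeriv]

/-- The parabolic operator `∂₀ g − ∑ᵢ ∂ᵢ∂ᵢ g + ∑ᵢ cᵢ ∂ᵢ g`. -/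
def parabolicOp (e₀ : E) (e : ι → E) (c : ι → E → ℝ) (g : E → ℝ) (p : E) : ℝ :=
  dirDeriv e₀ g p - ∑ i, dirDeriv (e i) (dirDeriv (e i) g) p + ∑ i, c i p * dirDeriv (e i) g p

variable {Ω : Set E} (e₀ : E) (e : ι → E) (c : ι → E → ℝ)

lemma parabolicOp_mul (hΩ : IsOpen Ω) {f g : E → ℝ} (hf : ContDiffOn ℝ (⊤ : ℕ∞) f Ω)
    (hg : ContDiffOn ℝ (⊤ : ℕ∞) g Ω) {p : E} (hp : p ∈ Ω) :
    parabolicOp e₀ e c (fun q => f q * g q) p =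
      f p * parabolicOp e₀ e c g p + g p * parabolicOp e₀ e c f p
        - 2 * ∑ i, dirDeriv (e i) f p * dirDeriv (e i) g p := by
  have hd {h : E → ℝ} (hh : ContDiffOn ℝ (⊤ : ℕ∞) h Ω) {q : E} (hq : q ∈ Ω) :
      DifferentiableAt ℝ h q := hh.differentiableAt_of_isOpen hΩ hq
  have h2 (i : ι) : dirDeriv (e i) (dirDeriv (e i) (fun q => f q * g q)) p =
      f p * dirDeriv (e i) (dirDeriv (e i) g) p + g p * dirDeriv (e i) (dirDeriv (e i) f) p
        + 2 * (dirDeriv (e i) f p * dirDeriv (e i) g p) := by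
    rw [dirDeriv_congr hΩ (fun q hq => dirDeriv_mul (hd hf hq) (hd hg hq)) hp]
    have hf' := hd (contDiffOn_dirDeriv (v := e i) hΩ hf) hp
    have hg' := hd (contDiffOn_dirDeriv (v := e i) hΩ hg) hp
    rw [dirDeriv_add ((hd hf hp).fun_mul hg') ((hd hg hp).fun_mul hf'), dirDeriv_mul (hd hf hp) hg',
      dirDeriv_mul (hd hg hp) hf']
    ring
  simp only [parabolicOp, h2, dirDeriv_mul (hd hf hp) (hd hg hp), Finset.sum_add_distrib,
    mul_add, mul_sub, Finset.mul_sum]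
  have h3 (i : ι) : c i p * (f p * dirDeriv (e i) g p) = f p * (c i p * dirDeriv (e i) g p) := by
    ring
  have h4 (i : ι) : c i p * (g p * dirDeriv (e i) f p) = g p * (c i p * dirDeriv (e i) f p) := by
    ring
  simp only [h3, h4]
  ring

lemma parabolicOp_add (hΩ : IsOpen Ω) {f g : E → ℝ} (hf : ContDiffOn ℝ (⊤ : ℕ∞) f Ω)
    (hg : ContDiffOn ℝ (⊤ : ℕ∞) g Ω) {p : E} (hp : p ∈ Ω) :
    parabolicOp e₀ e c (fun q => f q + g q) p =
      parabolicOp e₀ e c f p + parabolicOp e₀ e c g p := by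
  have hd {h : E → ℝ} (hh : ContDiffOn ℝ (⊤ : ℕ∞) h Ω) {q : E} (hq : q ∈ Ω) :
      DifferentiableAt ℝ h q := hh.differentiableAt_of_isOpen hΩ hq
  have h2 (i : ι) : dirDeriv (e i) (dirDeriv (e i) (fun q => f q + g q)) p =
      dirDeriv (e i) (dirDeriv (e i) f) p + dirDeriv (e i) (dirDeriv (e i) g) p := by
    rw [dirDeriv_congr hΩ (fun q hq => dirDeriv_add (hd hf hq) (hd hg hq)) hp,
      dirDeriv_add (hd (contDiffOn_dirDeriv hΩ hf) hp) (hd (contDiffOn_dirDeriv hΩ hg) hp)]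
  simp only [parabolicOp, h2, dirDeriv_add (hd hf hp) (hd hg hp), Finset.sum_add_distrib, mul_add]
  ring

lemma parabolicOp_const (a : ℝ) (p : E) : parabolicOp e₀ e c (fun _ => a) p = 0 := by
  have h (v : E) : dirDeriv v (fun _ : E => a) = fun _ => 0 := funext (dirDeriv_const v a)
  simp [parabolicOp, h, dirDeriv_const]

lemma parabolicOp_const_mul (hΩ : IsOpen Ω) (a : ℝ) {f : E → ℝ}
    (hf : ContDiffOn ℝ (⊤ : ℕ∞) f Ω) {p : E} (hp : p ∈ Ω) :
    parabolicOp e₀ e c (fun q => a * f q) p = a * parabolicOp e₀ e c f p := by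
  rw [parabolicOp_mul e₀ e c hΩ contDiffOn_const hf hp, parabolicOp_const]
  simp [dirDeriv_const]

lemma parabolicOp_sum {κ : Type*} (s : Finset κ) (hΩ : IsOpen Ω) {f : κ → E → ℝ}
    (hf : ∀ k, ContDiffOn ℝ (⊤ : ℕ∞) (f k) Ω) {p : E} (hp : p ∈ Ω) :
    parabolicOp e₀ e c (fun q => ∑ k ∈ s, f k q) p = ∑ k ∈ s, parabolicOp e₀ e c (f k) p := by
  classical
  induction s using Finset.induction_on with
  | empty => simpa using parabolicOp_const e₀ e c 0 p
  | insert a s ha ih =>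
    simp only [Finset.sum_insert ha]
    rw [parabolicOp_add e₀ e c hΩ (hf a) (ContDiffOn.sum fun k _ => hf k) hp, ih]

/-- The linearised operator applied to a directional derivative of a solution of
`∂₀ f = ∑ᵢ ∂ᵢ∂ᵢ f − ∑ᵢ bᵢ ∂ᵢ f + ∑ᵢ (∂ᵢ f)²`. -/
lemma parabolicOp_dirDeriv (hΩ : IsOpen Ω) {f : E → ℝ} {b : ι → E → ℝ}
    (hf : ContDiffOn ℝ (⊤ : ℕ∞) f Ω) (hb : ∀ i, ContDiffOn ℝ (⊤ : ℕ∞) (b i) Ω)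
    (heq : ∀ p ∈ Ω, dirDeriv e₀ f p = ∑ i, (dirDeriv (e i) (dirDeriv (e i) f) p
      - b i p * dirDeriv (e i) f p + dirDeriv (e i) f p * dirDeriv (e i) f p))
    (v : E) {p : E} (hp : p ∈ Ω) :
    parabolicOp e₀ e (fun i q => b i q - 2 * dirDeriv (e i) f q) (dirDeriv v f) p =
      - ∑ i, dirDeriv v (b i) p * dirDeriv (e i) f p := by
  have hd {h : E → ℝ} (hh : ContDiffOn ℝ (⊤ : ℕ∞) h Ω) {q : E} (hq : q ∈ Ω) :
      DifferentiableAt ℝ h q := hh.differentiableAt_of_isOpen hΩ hq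
  have hD (w : E) := contDiffOn_dirDeriv (v := w) hΩ hf
  have hDD (w z : E) := contDiffOn_dirDeriv (v := z) hΩ (hD w)
  have h0 : dirDeriv e₀ (dirDeriv v f) p = ∑ i, (dirDeriv (e i) (dirDeriv (e i) (dirDeriv v f)) p
      - (b i p * dirDeriv (e i) (dirDeriv v f) p + dirDeriv (e i) f p * dirDeriv v (b i) p)
      + (dirDeriv (e i) f p * dirDeriv (e i) (dirDeriv v f) p
        + dirDeriv (e i) f p * dirDeriv (e i) (dirDeriv v f) p)) := by
    rw [dirDeriv_comm hΩ hf hp, dirDeriv_congr hΩ heq hp, dirDeriv_sum]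
    · refine Finset.sum_congr rfl fun i _ => ?_
      have hbi := hd (hb i) hp
      have hfi := hd (hD (e i)) hp
      rw [dirDeriv_add ((hd (hDD (e i) (e i)) hp).fun_sub (hbi.fun_mul hfi)) (hfi.fun_mul hfi),
        dirDeriv_sub (hd (hDD (e i) (e i)) hp) (hbi.fun_mul hfi), dirDeriv_mul hbi hfi,
        dirDeriv_mul hfi hfi, dirDeriv_comm hΩ (hD (e i)) hp, dirDeriv_comm hΩ hf hp (v := v),
        dirDeriv_congr hΩ (fun q hq => dirDeriv_comm hΩ hf hq (v := v) (w := e i)) hp]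
    · intro i
      have hbi := hd (hb i) hp
      have hfi := hd (hD (e i)) hp
      exact ((hd (hDD (e i) (e i)) hp).fun_sub (hbi.fun_mul hfi)).fun_add (hfi.fun_mul hfi)
  simp only [parabolicOp, h0]
  rw [← Finset.sum_sub_distrib, ← Finset.sum_add_distrib, ← Finset.sum_neg_distrib]
  exact Finset.sum_congr rfl fun i _ => by ring

/-- Bochner's formula for the linearised operator. -/
lemma parabolicOp_sum_sq (hΩ : IsOpen Ω) {f : E → ℝ} {b : ι → E → ℝ}
    (hf : ContDiffOn ℝ (⊤ : ℕ∞) f Ω) (hb : ∀ i, ContDiffOn ℝ (⊤ : ℕ∞) (b i) Ω)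
    (heq : ∀ p ∈ Ω, dirDeriv e₀ f p = ∑ i, (dirDeriv (e i) (dirDeriv (e i) f) p
      - b i p * dirDeriv (e i) f p + dirDeriv (e i) f p * dirDeriv (e i) f p))
    {p : E} (hp : p ∈ Ω) :
    parabolicOp e₀ e (fun i q => b i q - 2 * dirDeriv (e i) f q)
        (fun q => ∑ k, dirDeriv (e k) f q * dirDeriv (e k) f q) p =
      -2 * (∑ k, ∑ i, dirDeriv (e i) (dirDeriv (e k) f) p ^ 2
        + ∑ k, ∑ i, dirDeriv (e k) (b i) p * dirDeriv (e i) f p * dirDeriv (e k) f p) := by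
  have hD (w : E) := contDiffOn_dirDeriv (v := w) hΩ hf
  rw [parabolicOp_sum _ _ _ _ hΩ (fun k => (hD (e k)).mul (hD (e k))) hp,
    ← Finset.sum_add_distrib, Finset.mul_sum]
  refine Finset.sum_congr rfl fun k _ => ?_
  rw [parabolicOp_mul _ _ _ hΩ (hD (e k)) (hD (e k)) hp,
    parabolicOp_dirDeriv e₀ e hΩ hf hb heq (e k) hp, ← Finset.sum_mul]
  simp only [pow_two]
  ring

end DirectionalCalculus

section SpaceTime

open Topology Filter Set

lemma dirDeriv_eq_deriv {E : Type*} [NormedAddCommGroup E] [NormedSpace ℝ E] {f : E → ℝ} {p v : E}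
    {r : ℝ} (hf : DifferentiableAt ℝ f (p + r • v)) :
    HasDerivAt (fun s : ℝ => f (p + s • v)) (dirDeriv v f (p + r • v)) r := by
  have h1 : HasDerivAt (fun s : ℝ => p + s • v) v r := by
    simpa using ((hasDerivAt_id r).smul_const v).const_add p
  exact hf.hasFDerivAt.comp_hasDerivAt r h1

/-- The second derivative test along a line at an interior maximum. -/
lemma dirDeriv_of_isLocalMax {E : Type*} [NormedAddCommGroup E] [NormedSpace ℝ E] {Ω : Set E}
    (hΩ : IsOpen Ω) {f : E → ℝ} (hf : ContDiffOn ℝ (⊤ : ℕ∞) f Ω) {p : E} (hp : p ∈ Ω) (v : E)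
    (hmax : IsLocalMax (fun s : ℝ => f (p + s • v)) 0) :
    dirDeriv v f p = 0 ∧ dirDeriv v (dirDeriv v f) p ≤ 0 := by
  set g : ℝ → ℝ := fun s => f (p + s • v) with hg
  have hline : ∀ᶠ s : ℝ in 𝓝 0, p + s • v ∈ Ω := by
    have hc : ContinuousAt (fun s : ℝ => p + s • v) 0 := by fun_prop
    exact hc (hΩ.mem_nhds (by simpa using hp))
  have hd1 : deriv g =ᶠ[𝓝 0] fun s => dirDeriv v f (p + s • v) := by
    filter_upwards [hline] with s hs
    exact (dirDeriv_eq_deriv (hf.differentiableAt_of_isOpen hΩ hs)).deriv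
  have hd0 : deriv g 0 = dirDeriv v f p := by simpa using hd1.eq_of_nhds
  have hd2 : deriv (deriv g) 0 = dirDeriv v (dirDeriv v f) p := by
    rw [hd1.deriv_eq]
    have := dirDeriv_eq_deriv (p := p) (v := v) (r := 0) (f := dirDeriv v f)
      (by simpa using (contDiffOn_dirDeriv hΩ hf).differentiableAt_of_isOpen hΩ hp)
    simpa using this.deriv
  have h0 : deriv g 0 = 0 := hmax.deriv_eq_zero
  refine ⟨hd0 ▸ h0, ?_⟩
  by_contra! hneg
  have hcont : ContinuousAt g 0 :=
    (dirDeriv_eq_deriv (p := p) (v := v) (r := 0)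
      (by simpa using hf.differentiableAt_of_isOpen hΩ hp)).continuousAt
  have hmin := isLocalMin_of_deriv_deriv_pos (by rw [hd2]; exact hneg) h0 hcont
  have hconst : g =ᶠ[𝓝 0] fun _ => g 0 := by
    filter_upwards [hmax, hmin] with s h1 h2 using le_antisymm h1 h2
  have h3 : deriv g =ᶠ[𝓝 0] fun _ => 0 := by
    simpa using hconst.deriv
  have h4 : deriv (deriv g) 0 = 0 := by rw [h3.deriv_eq]; simp
  linarith

variable {n : ℕ}

/-- The unit vector in the time direction. -/
def timeDir (n : ℕ) : ℝ × EuclideanSpace ℝ (Fin n) := (1, 0)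

/-- The `i`-th unit vector in the space directions. -/
def spaceDir (i : Fin n) : ℝ × EuclideanSpace ℝ (Fin n) := (0, EuclideanSpace.single i 1)

lemma dirDeriv_comp_fst {h : ℝ → ℝ} {h' : ℝ} {p : ℝ × EuclideanSpace ℝ (Fin n)}
    (hh : HasDerivAt h h' p.1) (v : ℝ × EuclideanSpace ℝ (Fin n)) :
    dirDeriv v (fun q => h q.1) p = v.1 * h' := by
  have h1 : HasFDerivAt (fun q : ℝ × EuclideanSpace ℝ (Fin n) => h q.1) _ p :=
    hh.hasFDerivAt.comp p hasFDerivAt_fst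
  rw [dirDeriv, h1.fderiv]
  simp

lemma dirDeriv_sq_norm (v p : ℝ × EuclideanSpace ℝ (Fin n)) :
    dirDeriv v (fun q => 1 + ‖q.2‖ ^ 2) p = 2 * ⟪p.2, v.2⟫ := by
  have h1 : HasFDerivAt (fun q : ℝ × EuclideanSpace ℝ (Fin n) => 1 + ‖q.2‖ ^ 2) _ p :=
    (hasFDerivAt_snd.norm_sq).const_add 1
  rw [dirDeriv, h1.fderiv]
  simp

lemma parabolicOp_comp_fst {I : Set ℝ} (hI : IsOpen I) {h h' : ℝ → ℝ}
    (hh : ∀ s ∈ I, HasDerivAt h (h' s) s)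
    (c : Fin n → ℝ × EuclideanSpace ℝ (Fin n) → ℝ) {p : ℝ × EuclideanSpace ℝ (Fin n)}
    (hp : p.1 ∈ I) :
    parabolicOp (timeDir n) spaceDir c (fun q => h q.1) p = h' p.1 := by
  have h1 (i : Fin n) (q : ℝ × EuclideanSpace ℝ (Fin n)) (hq : q ∈ I ×ˢ (univ : Set _)) :
      dirDeriv (spaceDir i) (fun q => h q.1) q = 0 := by
    rw [dirDeriv_comp_fst (hh _ hq.1)]; simp [spaceDir]
  have hp' : p ∈ I ×ˢ (univ : Set (EuclideanSpace ℝ (Fin n))) := ⟨hp, mem_univ _⟩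
  have h2 (i : Fin n) :
      dirDeriv (spaceDir i) (dirDeriv (spaceDir i) (fun q => h q.1)) p = 0 := by
    rw [dirDeriv_congr (hI.prod isOpen_univ) (h1 i) hp', dirDeriv_const]
  simp only [parabolicOp, h2, h1 _ _ hp', dirDeriv_comp_fst (hh _ hp)]
  simp [timeDir]

lemma parabolicOp_sq_norm (c : Fin n → ℝ × EuclideanSpace ℝ (Fin n) → ℝ)
    (p : ℝ × EuclideanSpace ℝ (Fin n)) :
    parabolicOp (timeDir n) spaceDir c (fun q => 1 + ‖q.2‖ ^ 2) p =
      - (2 * n) + ∑ i, 2 * (c i p * p.2 i) := by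
  have h1 (i : Fin n) : dirDeriv (spaceDir i) (fun q => 1 + ‖q.2‖ ^ 2) =
      fun q : ℝ × EuclideanSpace ℝ (Fin n) => 2 * q.2 i := by
    funext q
    rw [dirDeriv_sq_norm]
    simp [spaceDir, EuclideanSpace.inner_single_right]
  have h2 (i : Fin n) : dirDeriv (spaceDir i)
      (fun q : ℝ × EuclideanSpace ℝ (Fin n) => 2 * q.2 i) p = 2 := by
    have : HasFDerivAt (fun q : ℝ × EuclideanSpace ℝ (Fin n) => 2 * q.2 i)
        ((2 : ℝ) • ((EuclideanSpace.proj i : EuclideanSpace ℝ (Fin n) →L[ℝ] ℝ).comp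
          (ContinuousLinearMap.snd ℝ ℝ _))) p :=
      ((2 : ℝ) • ((EuclideanSpace.proj i : EuclideanSpace ℝ (Fin n) →L[ℝ] ℝ).comp
          (ContinuousLinearMap.snd ℝ ℝ (EuclideanSpace ℝ (Fin n))))).hasFDerivAt
    rw [dirDeriv, this.fderiv]
    simp [spaceDir]
  simp only [parabolicOp, h1, h2]
  rw [dirDeriv_sq_norm]
  simp only [timeDir, inner_zero_right, Finset.sum_const, Finset.card_univ, Fintype.card_fin,
    nsmul_eq_mul]
  have h3 (i : Fin n) : c i p * (2 * p.2 i) = 2 * (c i p * p.2 i) := by ring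
  simp only [h3]
  ring

lemma parabolicOp_barrier_pos (c : Fin n → ℝ × EuclideanSpace ℝ (Fin n) → ℝ) {C lam : ℝ}
    (hlam : 2 * n + n * C ^ 2 < lam) (hlam1 : 1 ≤ lam) {p : ℝ × EuclideanSpace ℝ (Fin n)}
    (hc : ∀ i, |c i p| ≤ C) :
    0 < parabolicOp (timeDir n) spaceDir c
      (fun q => Real.exp (lam * q.1) * (1 + ‖q.2‖ ^ 2)) p := by
  have hexp (s : ℝ) : HasDerivAt (fun s => Real.exp (lam * s)) (Real.exp (lam * s) * lam) s := by
    simpa using ((hasDerivAt_id s).const_mul lam).exp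
  rw [parabolicOp_mul (Ω := univ) (f := fun q => Real.exp (lam * q.1))
    (g := fun q => 1 + ‖q.2‖ ^ 2) _ _ _ isOpen_univ (by fun_prop)
    ((contDiff_const.add (contDiff_snd.norm_sq ℝ)).contDiffOn) (mem_univ p), parabolicOp_sq_norm,
    parabolicOp_comp_fst isOpen_univ (fun s _ => hexp s) c (mem_univ p.1)]
  have h0 : ∑ i, dirDeriv (spaceDir i) (fun q : ℝ × EuclideanSpace ℝ (Fin n) =>
      Real.exp (lam * q.1)) p * dirDeriv (spaceDir i) (fun q => 1 + ‖q.2‖ ^ 2) p = 0 :=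
    Finset.sum_eq_zero fun i _ => by
      rw [dirDeriv_comp_fst (hexp p.1)]; simp [spaceDir]
  rw [h0]
  have h1 : - (n * C ^ 2 + ‖p.2‖ ^ 2) ≤ ∑ i, 2 * (c i p * p.2 i) := by
    rw [EuclideanSpace.real_norm_sq_eq]
    have : (n : ℝ) * C ^ 2 = ∑ _i : Fin n, C ^ 2 := by simp
    rw [this, ← Finset.sum_add_distrib, ← Finset.sum_neg_distrib]
    refine Finset.sum_le_sum fun i _ => ?_
    have h2 : c i p ^ 2 ≤ C ^ 2 := sq_le_sq' (neg_le_of_abs_le (hc i)) (le_of_abs_le (hc i))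
    nlinarith [sq_nonneg (c i p + p.2 i)]
  have h2 : 0 < (-(2 * n) + ∑ i, 2 * (c i p * p.2 i)) + (1 + ‖p.2‖ ^ 2) * lam := by
    nlinarith [mul_nonneg (sq_nonneg ‖p.2‖) (sub_nonneg.2 hlam1)]
  have h3 := mul_pos (Real.exp_pos (lam * p.1)) h2
  nlinarith

lemma quadratic_form_lower_bound {m K : ℝ} (hn : 1 ≤ n) (hm : (n : ℝ) < m)
    (F P : Fin n → Fin n → ℝ) (b v : Fin n → ℝ)
    (hCD : -K * ∑ i, v i ^ 2 ≤ ∑ k, ∑ i, P k i * v i * v k - (∑ i, b i * v i) ^ 2 / (m - n)) :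
    (∑ i, (F i i - b i * v i)) ^ 2 / m - K * ∑ i, v i ^ 2 ≤
      ∑ k, ∑ i, F k i ^ 2 + ∑ k, ∑ i, P k i * v i * v k := by
  have hn' : (0 : ℝ) < n := by exact_mod_cast hn
  have h1 : ∑ k, F k k ^ 2 ≤ ∑ k, ∑ i, F k i ^ 2 :=
    Finset.sum_le_sum fun k _ =>
      Finset.single_le_sum (f := fun i => F k i ^ 2) (fun i _ => sq_nonneg _) (Finset.mem_univ k)
  have h2 : (∑ k, F k k) ^ 2 / n ≤ ∑ k, F k k ^ 2 := by
    rw [div_le_iff₀' hn']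
    simpa using sq_sum_le_card_mul_sum_sq (s := Finset.univ) (f := fun k => F k k)
  rw [Finset.sum_sub_distrib]
  set x := ∑ k, F k k
  set y := ∑ i, b i * v i
  have h3 : (x - y) ^ 2 / m ≤ x ^ 2 / n + y ^ 2 / (m - n) := by
    have hmn : 0 < m - n := sub_pos.2 hm
    have hm0 : 0 < m := hn'.trans hm
    have : x ^ 2 / n + y ^ 2 / (m - n) - (x - y) ^ 2 / m =
        ((m - n) * x + n * y) ^ 2 / (n * (m - n) * m) := by
      field_simp
      ring
    have h4 : 0 ≤ ((m - n) * x + n * y) ^ 2 / (n * (m - n) * m) := by positivity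
    linarith
  linarith

lemma hamilton_scalar_inequality {m K s X Y : ℝ} (hm : 0 < m) (hK : 0 ≤ K) (hs : 0 ≤ s)
    (hY : 0 ≤ Y) (h : m < s / (1 + K * s) * (X + Y)) :
    1 / (1 + K * s) ^ 2 * (X + Y) +
      s / (1 + K * s) * (-2 * ((X - Y) ^ 2 / m - K * Y)) - 4 * Y ≤ 0 := by
  have hσ : 1 ≤ 1 + K * s := by nlinarith [mul_nonneg hK hs]
  set σ := 1 + K * s with hσdef
  have hσ0 : 0 < σ := by linarith
  set ψ := s / σ with hψ
  have hψ0 : 0 ≤ ψ := by positivity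
  have hψK : ψ * K = 1 - 1 / σ := by
    rw [hψ, div_mul_eq_mul_div, eq_sub_iff_add_eq, ← add_div, div_eq_one_iff_eq hσ0.ne']
    rw [hσdef]; ring
  have hXY : 0 < X + Y := by
    by_contra! hc
    nlinarith [mul_nonneg hψ0 (neg_nonneg.2 hc)]
  set ω := 1 / σ with hω
  have hω0 : 0 < ω := by positivity
  have hω1 : ω ≤ 1 := by rw [hω, div_le_one hσ0]; exact hσ
  have hσ2 : 1 / σ ^ 2 = ω ^ 2 := by rw [hω, div_pow, one_pow]
  rw [hσ2]
  have hω2 : ω ^ 2 ≤ ω := by nlinarith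
  have hgood : 2 * (X - Y) ^ 2 / (X + Y) ≤ 2 * (ψ * ((X - Y) ^ 2 / m)) := by
    rw [div_le_iff₀ hXY]
    have : 2 * (ψ * ((X - Y) ^ 2 / m)) * (X + Y) = 2 * (X - Y) ^ 2 * (ψ * (X + Y) / m) := by
      ring
    rw [this]
    have h1 : 1 ≤ ψ * (X + Y) / m := by rw [le_div_iff₀ hm]; linarith
    nlinarith [sq_nonneg (X - Y)]
  have hexpand : ω ^ 2 * (X + Y) + ψ * (-2 * ((X - Y) ^ 2 / m - K * Y)) - 4 * Y =
      ω ^ 2 * (X + Y) - 2 * (ψ * ((X - Y) ^ 2 / m)) + 2 * (ψ * K) * Y - 4 * Y := by ring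
  rw [hexpand, hψK]
  have h5 : (X - Y) - 2 * Y ≤ 2 * (X - Y) ^ 2 / (X + Y) := by
    rw [le_div_iff₀ hXY]
    nlinarith [sq_nonneg (X - Y), sq_nonneg Y]
  rcases le_total X Y with hle | hle
  · have : 0 ≤ 2 * (X - Y) ^ 2 / (X + Y) := by positivity
    nlinarith [mul_nonneg hω0.le hY, mul_le_mul_of_nonneg_right hω2 hXY.le]
  · nlinarith [mul_nonneg hω0.le hY, mul_le_mul_of_nonneg_right hω2 hXY.le,
      mul_nonneg (sub_nonneg.2 hω1) (sub_nonneg.2 hle)]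

/-- At a maximum over a slab `[τ, t₀] × ℝⁿ` attained after the initial time, the parabolic
operator is nonnegative. -/
lemma parabolicOp_nonneg_of_isMaxOn {α β τ t₀ : ℝ} (hατ : α < τ) (ht₀ : t₀ < β)
    (c : Fin n → ℝ × EuclideanSpace ℝ (Fin n) → ℝ) {H : ℝ × EuclideanSpace ℝ (Fin n) → ℝ}
    (hH : ContDiffOn ℝ (⊤ : ℕ∞) H (Ioo α β ×ˢ univ)) {p : ℝ × EuclideanSpace ℝ (Fin n)}
    (hp : p.1 ∈ Ioc τ t₀) (hmax : IsMaxOn H (Icc τ t₀ ×ˢ univ) p) :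
    0 ≤ parabolicOp (timeDir n) spaceDir c H p := by
  have hΩ : IsOpen (Ioo α β ×ˢ (univ : Set (EuclideanSpace ℝ (Fin n)))) :=
    isOpen_Ioo.prod isOpen_univ
  have hpΩ : p ∈ Ioo α β ×ˢ (univ : Set (EuclideanSpace ℝ (Fin n))) :=
    ⟨⟨hατ.trans hp.1, hp.2.trans_lt ht₀⟩, mem_univ _⟩
  have hspace (i : Fin n) := dirDeriv_of_isLocalMax hΩ hH hpΩ (spaceDir i) (by
    refine Eventually.of_forall fun s => ?_
    have hs : p + s • spaceDir i ∈ Icc τ t₀ ×ˢ (univ : Set (EuclideanSpace ℝ (Fin n))) := by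
      simpa [spaceDir] using ⟨hp.1.le, hp.2⟩
    simpa using hmax hs)
  have htime : 0 ≤ dirDeriv (timeDir n) H p := by
    have hmem : (τ - p.1) • timeDir n ∈
        posTangentConeAt (Icc τ t₀ ×ˢ (univ : Set (EuclideanSpace ℝ (Fin n)))) p := by
      refine mem_posTangentConeAt_of_segment_subset ?_
      refine ((convex_Icc τ t₀).prod convex_univ).segment_subset
        ⟨Ioc_subset_Icc_self hp, mem_univ _⟩ ⟨?_, mem_univ _⟩
      simpa [timeDir] using hp.1.le.trans hp.2
    have h1 := hmax.localize.hasFDerivWithinAt_nonpos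
      (hH.differentiableAt_of_isOpen hΩ hpΩ).hasFDerivAt.hasFDerivWithinAt hmem
    rw [map_smul, smul_eq_mul] at h1
    unfold dirDeriv
    by_contra! hneg
    nlinarith [mul_pos_of_neg_of_neg (sub_neg.2 hp.1) hneg]
  have h2 : ∑ i, dirDeriv (spaceDir i) (dirDeriv (spaceDir i) H) p ≤ 0 :=
    Finset.sum_nonpos fun i _ => (hspace i).2
  have h3 : ∑ i, c i p * dirDeriv (spaceDir i) H p = 0 :=
    Finset.sum_eq_zero fun i _ => by rw [(hspace i).1, mul_zero]
  rw [parabolicOp, h3]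
  linarith

/-- Hamilton's estimate for the logarithm `f` of a solution: `f` solves
`∂₀ f = Δ f − ⟨b, ∇f⟩ + |∇f|²`. -/
theorem hamilton_estimate_log (hn : 1 ≤ n) {m K α β τ a B : ℝ} (hm : (n : ℝ) < m) (hK : 0 ≤ K)
    (hατ : α < τ) (hατK : K * (τ - α) < 1)
    {f : ℝ × EuclideanSpace ℝ (Fin n) → ℝ} {b : Fin n → ℝ × EuclideanSpace ℝ (Fin n) → ℝ}
    (hf : ContDiffOn ℝ (⊤ : ℕ∞) f (Ioo α β ×ˢ univ))
    (hb : ∀ i, ContDiffOn ℝ (⊤ : ℕ∞) (b i) (Ioo α β ×ˢ univ))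
    (hbt : ∀ i, ∀ p, dirDeriv (timeDir n) (b i) p = 0)
    (hCD : ∀ p, ∀ v : Fin n → ℝ, -K * ∑ i, v i ^ 2 ≤
      ∑ k, ∑ i, dirDeriv (spaceDir k) (b i) p * v i * v k - (∑ i, b i p * v i) ^ 2 / (m - n))
    (heq : ∀ p ∈ Ioo α β ×ˢ univ, dirDeriv (timeDir n) f p =
      ∑ i, (dirDeriv (spaceDir i) (dirDeriv (spaceDir i) f) p
        - b i p * dirDeriv (spaceDir i) f p + dirDeriv (spaceDir i) f p * dirDeriv (spaceDir i) f p))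
    (hbB : ∀ i, ∀ p, |b i p| ≤ B)
    (hfB : ∀ i, ∀ p ∈ Ioo α β ×ˢ univ, |dirDeriv (spaceDir i) f p| ≤ B)
    (hft : ∀ p ∈ Ioo α β ×ˢ univ, dirDeriv (timeDir n) f p ≤ B)
    (hfa : ∀ p ∈ Ioo α β ×ˢ univ, f p ≤ a)
    {q : ℝ × EuclideanSpace ℝ (Fin n)} (hq : q.1 ∈ Ioo τ β) :
    (q.1 - τ) / (1 + K * (q.1 - τ)) * (dirDeriv (timeDir n) f q
      + ∑ i, dirDeriv (spaceDir i) f q * dirDeriv (spaceDir i) f q) ≤ m + 4 * (a - f q) := by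
  set Ω := Ioo α β ×ˢ (univ : Set (EuclideanSpace ℝ (Fin n))) with hΩdef
  have hΩ : IsOpen Ω := isOpen_Ioo.prod isOpen_univ
  have hm0 : 0 < m := lt_of_le_of_lt (Nat.cast_nonneg n) hm
  have hσ : ∀ s ∈ Ioo α β, 0 < 1 + K * (s - τ) := fun s hs => by
    nlinarith [mul_nonneg hK (sub_nonneg.2 hs.1.le)]
  set ψ : ℝ → ℝ := fun s => (s - τ) / (1 + K * (s - τ)) with hψ
  set G : ℝ × EuclideanSpace ℝ (Fin n) → ℝ := fun p => dirDeriv (timeDir n) f p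
    + ∑ i, dirDeriv (spaceDir i) f p * dirDeriv (spaceDir i) f p with hG
  set c : Fin n → ℝ × EuclideanSpace ℝ (Fin n) → ℝ :=
    fun i p => b i p - 2 * dirDeriv (spaceDir i) f p with hc
  by_contra! hcon
  have hcon' : 0 < ψ q.1 * G q - (m + 4 * (a - f q)) := sub_pos.2 hcon
  set lam : ℝ := 2 * n + n * (3 * B) ^ 2 + 1 with hlam
  set w : ℝ × EuclideanSpace ℝ (Fin n) → ℝ :=
    fun p => Real.exp (lam * p.1) * (1 + ‖p.2‖ ^ 2) with hw
  have hwpos (p) : 0 < w p := by positivity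
  obtain ⟨δ, hδ, hδq⟩ : ∃ δ : ℝ, 0 < δ ∧ δ * w q < ψ q.1 * G q - (m + 4 * (a - f q)) := by
    refine ⟨(ψ q.1 * G q - (m + 4 * (a - f q))) / (2 * w q),
      div_pos hcon' (mul_pos two_pos (hwpos q)), ?_⟩
    have hwq := (hwpos q).ne'
    have : (ψ q.1 * G q - (m + 4 * (a - f q))) / (2 * w q) * w q =
        (ψ q.1 * G q - (m + 4 * (a - f q))) / 2 := by field_simp
    rw [this]
    linarith
  set H : ℝ × EuclideanSpace ℝ (Fin n) → ℝ :=
    fun p => ψ p.1 * G p + (4 * f p + (-(m + 4 * a) + -δ * w p)) with hHdef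
  have hHq : 0 < H q := by simp only [hHdef]; linarith
  have hψsm : ContDiffOn ℝ (⊤ : ℕ∞) (fun p : ℝ × EuclideanSpace ℝ (Fin n) => ψ p.1) Ω := by
    refine ContDiffOn.div (by fun_prop) (by fun_prop) fun p hp => (hσ p.1 hp.1).ne'
  have hDsm (v) : ContDiffOn ℝ (⊤ : ℕ∞) (dirDeriv v f) Ω := contDiffOn_dirDeriv hΩ hf
  have hSsm : ContDiffOn ℝ (⊤ : ℕ∞)
      (fun p => ∑ i : Fin n, dirDeriv (spaceDir i) f p * dirDeriv (spaceDir i) f p) Ω :=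
    ContDiffOn.sum fun i _ => (hDsm _).mul (hDsm _)
  have hGsm : ContDiffOn ℝ (⊤ : ℕ∞) G Ω := (hDsm _).add hSsm
  have hwsm : ContDiffOn ℝ (⊤ : ℕ∞) w Ω :=
    ContDiffOn.mul (by fun_prop) ((contDiff_const.add (contDiff_snd.norm_sq ℝ)).contDiffOn)
  have hδwsm : ContDiffOn ℝ (⊤ : ℕ∞) (fun p => -δ * w p) Ω := contDiffOn_const.mul hwsm
  have hψGsm : ContDiffOn ℝ (⊤ : ℕ∞) (fun p => ψ p.1 * G p) Ω := hψsm.mul hGsm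
  have h4fsm : ContDiffOn ℝ (⊤ : ℕ∞) (fun p => 4 * f p) Ω := contDiffOn_const.mul hf
  have htail : ContDiffOn ℝ (⊤ : ℕ∞) (fun p => -(m + 4 * a) + -δ * w p) Ω :=
    contDiffOn_const.add hδwsm
  have hHsm : ContDiffOn ℝ (⊤ : ℕ∞) H Ω := hψGsm.add (h4fsm.add htail)
  have hGB : ∀ p ∈ Ω, G p ≤ |B| + n * B ^ 2 := fun p hp => by
    refine add_le_add ((hft p hp).trans (le_abs_self B)) ?_
    have : (n : ℝ) * B ^ 2 = ∑ _i : Fin n, B ^ 2 := by simp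
    rw [this]
    refine Finset.sum_le_sum fun i _ => ?_
    rw [← pow_two]
    exact sq_le_sq' (neg_le_of_abs_le (hfB i p hp)) (le_of_abs_le (hfB i p hp))
  have hΩmem {s : ℝ} (hs : s ∈ Icc τ q.1) (x : EuclideanSpace ℝ (Fin n)) : (s, x) ∈ Ω :=
    ⟨⟨hατ.trans_le hs.1, hs.2.trans_lt hq.2⟩, mem_univ _⟩
  set M : ℝ := (q.1 - τ) * (|B| + n * B ^ 2) with hM
  have hM0 : 0 ≤ M := mul_nonneg (sub_nonneg.2 hq.1.le) (by positivity)
  set ε : ℝ := δ * Real.exp (lam * τ) with hε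
  have hε0 : 0 < ε := by positivity
  have hlam1 : 1 ≤ lam := by
    have h1 : (0 : ℝ) ≤ 2 * n + n * (3 * B) ^ 2 := by positivity
    linarith
  have hHle : ∀ p : ℝ × EuclideanSpace ℝ (Fin n), p.1 ∈ Icc τ q.1 →
      H p ≤ M - m - ε * ‖p.2‖ ^ 2 := fun p hp => by
    have hpΩ : p ∈ Ω := hΩmem hp p.2
    have hs0 : 0 ≤ p.1 - τ := sub_nonneg.2 hp.1
    have hσ1 : 1 ≤ 1 + K * (p.1 - τ) := by nlinarith [mul_nonneg hK hs0]
    have h1 : ψ p.1 ≤ q.1 - τ := (div_le_self hs0 hσ1).trans (by linarith [hp.2])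
    have h0 : 0 ≤ ψ p.1 := div_nonneg hs0 (by linarith)
    have h2 : ψ p.1 * G p ≤ M :=
      (mul_le_mul_of_nonneg_left (hGB p hpΩ) h0).trans
        (mul_le_mul_of_nonneg_right h1 (by positivity))
    have h3 : ε * ‖p.2‖ ^ 2 ≤ δ * w p := by
      rw [hε, hw, mul_assoc]
      refine mul_le_mul_of_nonneg_left ?_ hδ.le
      refine mul_le_mul (Real.exp_le_exp.2 ?_) (by linarith) (by positivity) (by positivity)
      exact mul_le_mul_of_nonneg_left hp.1 (by linarith)
    have h4 := hfa p hpΩ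
    simp only [hHdef]
    linarith
  set R : ℝ := M / ε + 1 + ‖q.2‖ with hR
  have hR1 : 1 ≤ R := by
    have : 0 ≤ M / ε := by positivity
    linarith [norm_nonneg q.2]
  have hout : ∀ p : ℝ × EuclideanSpace ℝ (Fin n), p.1 ∈ Icc τ q.1 → R < ‖p.2‖ → H p < 0 :=
    fun p hp hpR => by
      have h1 : M / ε ≤ ‖p.2‖ ^ 2 := by nlinarith [norm_nonneg q.2]
      rw [div_le_iff₀' hε0] at h1
      linarith [hHle p hp]
  have hqmem : q ∈ Icc τ q.1 ×ˢ Metric.closedBall (0 : EuclideanSpace ℝ (Fin n)) R := by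
    refine ⟨⟨hq.1.le, le_rfl⟩, ?_⟩
    have : 0 ≤ M / ε := by positivity
    rw [mem_closedBall_zero_iff]
    linarith
  obtain ⟨p, hpmem, hpmax⟩ := (isCompact_Icc.prod
    (isCompact_closedBall (0 : EuclideanSpace ℝ (Fin n)) R)).exists_isMaxOn ⟨q, hqmem⟩
    (hHsm.continuousOn.mono fun p hp => hΩmem hp.1 p.2)
  have hHp : 0 < H p := hHq.trans_le (hpmax hqmem)
  have hpmax' : IsMaxOn H (Icc τ q.1 ×ˢ univ) p := fun z hz => by
    by_cases hzR : ‖z.2‖ ≤ R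
    · exact hpmax ⟨hz.1, mem_closedBall_zero_iff.2 hzR⟩
    · exact ((hout z hz.1 (not_le.1 hzR)).trans hHp).le
  have hpΩ : p ∈ Ω := hΩmem hpmem.1 p.2
  have hQp : m < ψ p.1 * G p := by
    have := mul_pos hδ (hwpos p)
    have := hfa p hpΩ
    simp only [hHdef] at hHp
    linarith
  have hpτ : τ < p.1 := by
    refine lt_of_le_of_ne hpmem.1.1 fun h => ?_
    have : ψ p.1 = 0 := by simp [hψ, ← h]
    rw [this, zero_mul] at hQp
    linarith
  have hLH := parabolicOp_nonneg_of_isMaxOn hατ hq.2 c hHsm ⟨hpτ, hpmem.1.2⟩ hpmax'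
  have hψd : ∀ s ∈ Ioo α β, HasDerivAt ψ (1 / (1 + K * (s - τ)) ^ 2) s := fun s hs => by
    have h1 : HasDerivAt (fun s => s - τ) 1 s := (hasDerivAt_id s).sub_const τ
    have h2 : HasDerivAt (fun s => 1 + K * (s - τ)) (K * 1) s := (h1.const_mul K).const_add 1
    have h3 := h1.div h2 (hσ s hs).ne'
    rwa [show 1 * (1 + K * (s - τ)) - (s - τ) * (K * 1) = 1 by ring] at h3
  have hψL := parabolicOp_comp_fst isOpen_Ioo hψd c hpΩ.1
  have hcross : ∑ i, dirDeriv (spaceDir i) (fun p => ψ p.1) p * dirDeriv (spaceDir i) G p = 0 :=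
    Finset.sum_eq_zero fun i _ => by
      rw [dirDeriv_comp_fst (hψd p.1 hpΩ.1)]; simp [spaceDir]
  set Y : ℝ := ∑ i, dirDeriv (spaceDir i) f p ^ 2 with hY
  set X : ℝ := dirDeriv (timeDir n) f p with hX
  have hYG : ∑ i, dirDeriv (spaceDir i) f p * dirDeriv (spaceDir i) f p = Y := by
    simp only [hY, pow_two]
  have hGp : G p = X + Y := by simp only [hG, hYG, hX]
  have hXY : ∑ i, (dirDeriv (spaceDir i) (dirDeriv (spaceDir i) f) p
      - b i p * dirDeriv (spaceDir i) f p) = X - Y := by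
    rw [hX, heq p hpΩ, Finset.sum_add_distrib, hYG]
    ring
  have hfL : parabolicOp (timeDir n) spaceDir c f p = -Y := by
    rw [Finset.sum_sub_distrib] at hXY
    simp only [parabolicOp, hc, sub_mul, Finset.sum_sub_distrib, mul_assoc, ← Finset.mul_sum, hYG]
    linarith
  have hGL : parabolicOp (timeDir n) spaceDir c G p ≤ -2 * ((X - Y) ^ 2 / m - K * Y) := by
    rw [hG, parabolicOp_add _ _ _ hΩ (hDsm _) hSsm hpΩ,
      parabolicOp_dirDeriv _ _ hΩ hf hb heq _ hpΩ, parabolicOp_sum_sq _ _ hΩ hf hb heq hpΩ]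
    have h1 := quadratic_form_lower_bound hn hm
      (fun k i => dirDeriv (spaceDir i) (dirDeriv (spaceDir k) f) p)
      (fun k i => dirDeriv (spaceDir k) (b i) p) (fun i => b i p)
      (fun i => dirDeriv (spaceDir i) f p) (hCD p _)
    rw [hXY] at h1
    simp only [hbt, zero_mul, Finset.sum_const_zero]
    linarith
  have hwL : 0 < parabolicOp (timeDir n) spaceDir c w p := by
    refine parabolicOp_barrier_pos c (C := 3 * B) (by linarith) hlam1 fun i => ?_
    have h1 := abs_le.1 (hbB i p)
    have h2 := abs_le.1 (hfB i p hpΩ)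
    exact abs_le.2 ⟨by simp only [hc]; linarith, by simp only [hc]; linarith⟩
  have hLHeq : parabolicOp (timeDir n) spaceDir c H p =
      1 / (1 + K * (p.1 - τ)) ^ 2 * (X + Y) + ψ p.1 * parabolicOp (timeDir n) spaceDir c G p
        - 4 * Y - δ * parabolicOp (timeDir n) spaceDir c w p := by
    rw [hHdef, parabolicOp_add _ _ _ hΩ hψGsm (h4fsm.add htail) hpΩ,
      parabolicOp_add _ _ _ hΩ h4fsm htail hpΩ, parabolicOp_add _ _ _ hΩ contDiffOn_const hδwsm hpΩ,
      parabolicOp_const, parabolicOp_const_mul _ _ _ hΩ _ hf hpΩ,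
      parabolicOp_const_mul _ _ _ hΩ _ hwsm hpΩ, parabolicOp_mul _ _ _ hΩ hψsm hGsm hpΩ,
      hcross, hψL, hfL, hGp]
    ring
  have hs0 : 0 ≤ p.1 - τ := sub_nonneg.2 hpτ.le
  have hY0 : 0 ≤ Y := Finset.sum_nonneg fun i _ => sq_nonneg _
  have hψ0 : 0 ≤ ψ p.1 := div_nonneg hs0 (hσ p.1 hpΩ.1).le
  have hfinal := hamilton_scalar_inequality hm0 hK hs0 hY0 (by rw [← hGp]; exact hQp)
  have := mul_le_mul_of_nonneg_left hGL hψ0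
  have := mul_pos hδ hwL
  simp only [hψ] at *
  linarith

lemma fderiv_slice_eq_dirDeriv {g : ℝ → EuclideanSpace ℝ (Fin n) → ℝ} {t : ℝ}
    {x : EuclideanSpace ℝ (Fin n)}
    (hg : DifferentiableAt ℝ (fun p : ℝ × EuclideanSpace ℝ (Fin n) => g p.1 p.2) (t, x))
    (v : EuclideanSpace ℝ (Fin n)) :
    fderiv ℝ (g t) x v = dirDeriv ((0 : ℝ), v) (fun p => g p.1 p.2) (t, x) := by
  have h1 : HasFDerivAt (fun y : EuclideanSpace ℝ (Fin n) => (t, y))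
      (ContinuousLinearMap.inr ℝ ℝ (EuclideanSpace ℝ (Fin n))) x := hasFDerivAt_prodMk_right t x
  have h2 : HasFDerivAt (g t) _ x := hg.hasFDerivAt.comp x h1
  rw [h2.fderiv, dirDeriv]
  simp

lemma deriv_slice_eq_dirDeriv {g : ℝ → EuclideanSpace ℝ (Fin n) → ℝ} {t : ℝ}
    {x : EuclideanSpace ℝ (Fin n)}
    (hg : DifferentiableAt ℝ (fun p : ℝ × EuclideanSpace ℝ (Fin n) => g p.1 p.2) (t, x)) :
    deriv (fun s => g s x) t = dirDeriv (timeDir n) (fun p => g p.1 p.2) (t, x) := by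
  have h1 : HasDerivAt (fun s : ℝ => (s, x)) (timeDir n) t :=
    (hasDerivAt_id t).prodMk (hasDerivAt_const t x)
  exact (hg.hasFDerivAt.comp_hasDerivAt t h1).deriv

lemma dirDeriv_comp_snd {g : EuclideanSpace ℝ (Fin n) → ℝ}
    {p : ℝ × EuclideanSpace ℝ (Fin n)} (hg : DifferentiableAt ℝ g p.2)
    (v : ℝ × EuclideanSpace ℝ (Fin n)) :
    dirDeriv v (fun q => g q.2) p = fderiv ℝ g p.2 v.2 := by
  have h1 : HasFDerivAt (fun q : ℝ × EuclideanSpace ℝ (Fin n) => g q.2) _ p :=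
    hg.hasFDerivAt.comp p hasFDerivAt_snd
  rw [dirDeriv, h1.fderiv]
  simp

lemma inner_gradient_eq_sum (f g : EuclideanSpace ℝ (Fin n) → ℝ) (x : EuclideanSpace ℝ (Fin n)) :
    ⟪gradient f x, gradient g x⟫ = ∑ i, fderiv ℝ f x (EuclideanSpace.single i 1) *
      fderiv ℝ g x (EuclideanSpace.single i 1) := by
  rw [← (EuclideanSpace.basisFun (Fin n) ℝ).sum_inner_mul_inner]
  refine Finset.sum_congr rfl fun i _ => ?_
  rw [EuclideanSpace.basisFun_apply, inner_gradient_left, real_inner_comm, inner_gradient_left]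

lemma abs_fderiv_single_le (f : EuclideanSpace ℝ (Fin n) → ℝ) (x : EuclideanSpace ℝ (Fin n))
    (i : Fin n) : |fderiv ℝ f x (EuclideanSpace.single i 1)| ≤ ‖gradient f x‖ := by
  rw [← inner_gradient_left]
  simpa using abs_real_inner_le_norm (gradient f x) (EuclideanSpace.single i (1 : ℝ))

lemma CDcond.coordinates {φ : EuclideanSpace ℝ (Fin n) → ℝ} {m K : ℝ} (hCD : CDcond n φ m K)
    (hφ : ContDiff ℝ (⊤ : ℕ∞) φ) (x : EuclideanSpace ℝ (Fin n)) (v : Fin n → ℝ) :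
    -K * ∑ i, v i ^ 2 ≤ ∑ k, ∑ i, hess n φ x (EuclideanSpace.single i 1)
        (EuclideanSpace.single k 1) * v i * v k
      - (∑ i, fderiv ℝ φ x (EuclideanSpace.single i 1) * v i) ^ 2 / (m - n) := by
  have hd : DifferentiableAt ℝ (fderiv ℝ φ) x :=
    ((hφ.fderiv_right (m := (⊤ : ℕ∞)) le_rfl).differentiable (by simp)).differentiableAt
  have hh (y z : EuclideanSpace ℝ (Fin n)) : hess n φ x y z = fderiv ℝ (fderiv ℝ φ) x z y :=
    dirDeriv_dirDeriv_eq hd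
  have hv : WithLp.toLp 2 v = ∑ i, v i • (EuclideanSpace.single i 1 : EuclideanSpace ℝ (Fin n)) := by
    ext j
    simp [Finset.sum_apply, Pi.single_apply]
  have h := hCD x (WithLp.toLp 2 v)
  rw [hh, inner_gradient_left, EuclideanSpace.real_norm_sq_eq] at h
  have h1 : fderiv ℝ φ x (WithLp.toLp 2 v) =
      ∑ i, fderiv ℝ φ x (EuclideanSpace.single i 1) * v i := by
    rw [hv, map_sum]
    exact Finset.sum_congr rfl fun i _ => by rw [map_smul, smul_eq_mul, mul_comm]
  have h2 : fderiv ℝ (fderiv ℝ φ) x (WithLp.toLp 2 v) (WithLp.toLp 2 v) =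
      ∑ k, ∑ i, hess n φ x (EuclideanSpace.single i 1) (EuclideanSpace.single k 1)
        * v i * v k := by
    rw [hv, map_sum, Finset.sum_comm]
    refine Finset.sum_congr rfl fun i _ => ?_
    rw [map_sum, sum_apply]
    refine Finset.sum_congr rfl fun k _ => ?_
    rw [hh]
    simp only [map_smul, smul_apply, smul_eq_mul]
    ring
  rw [h1, h2] at h
  exact h

section Logarithm

variable {E : Type*} [NormedAddCommGroup E] [NormedSpace ℝ E] {Ω : Set E} {V : E → ℝ}

lemma dirDeriv_log (hΩ : IsOpen Ω) (hV : ContDiffOn ℝ (⊤ : ℕ∞) V Ω) (hpos : ∀ p ∈ Ω, 0 < V p)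
    {p : E} (hp : p ∈ Ω) (v : E) :
    dirDeriv v (fun q => Real.log (V q)) p = dirDeriv v V p / V p := by
  rw [dirDeriv, fderiv.log (hV.differentiableAt_of_isOpen hΩ hp) (hpos p hp).ne']
  simp [dirDeriv, div_eq_inv_mul]

lemma dirDeriv_dirDeriv_log (hΩ : IsOpen Ω) (hV : ContDiffOn ℝ (⊤ : ℕ∞) V Ω)
    (hpos : ∀ p ∈ Ω, 0 < V p) {p : E} (hp : p ∈ Ω) (v : E) :
    dirDeriv v (dirDeriv v (fun q => Real.log (V q))) p =
      dirDeriv v (dirDeriv v V) p / V p - (dirDeriv v V p / V p) ^ 2 := by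
  have hlog : ContDiffOn ℝ (⊤ : ℕ∞) (fun q => Real.log (V q)) Ω :=
    hV.log fun q hq => (hpos q hq).ne'
  have h1 : dirDeriv v (dirDeriv v V) p =
      dirDeriv v (fun q => dirDeriv v (fun q => Real.log (V q)) q * V q) p :=
    dirDeriv_congr hΩ (fun q hq => by
      rw [dirDeriv_log hΩ hV hpos hq, div_mul_cancel₀ _ (hpos q hq).ne']) hp
  rw [dirDeriv_mul ((contDiffOn_dirDeriv hΩ hlog).differentiableAt_of_isOpen hΩ hp)
    (hV.differentiableAt_of_isOpen hΩ hp), dirDeriv_log hΩ hV hpos hp] at h1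
  have := (hpos p hp).ne'
  rw [h1]
  field_simp
  ring

end Logarithm

/-- Hamilton's estimate at interior times, for the solution shifted by `ε` and started at `τ`. -/
lemma hamilton_estimate_shifted
    (hn : 1 ≤ n) {m K T : ℝ} (hm : (n : ℝ) < m) (hK : 0 ≤ K)
    {φ : EuclideanSpace ℝ (Fin n) → ℝ} (hφ : ContDiff ℝ (⊤ : ℕ∞) φ)
    (hCD : CDcond n φ m K)
    (hgradφ : ∃ C, ∀ x, ‖gradient φ x‖ ≤ C)
    {u : ℝ → EuclideanSpace ℝ (Fin n) → ℝ}
    (hu : ContDiffOn ℝ (⊤ : ℕ∞) (fun p : ℝ × EuclideanSpace ℝ (Fin n) => u p.1 p.2)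
      (Ioo 0 T ×ˢ univ))
    (hpos : ∀ t ∈ Ioo (0 : ℝ) T, ∀ x, 0 < u t x)
    (hheat : ∀ t ∈ Ioo (0 : ℝ) T, ∀ x, deriv (fun s => u s x) t = witten n φ (u t) x)
    {C A : ℝ}
    (hbd : ∀ t ∈ Ioo (0 : ℝ) T, ∀ x,
      |deriv (fun s => u s x) t| ≤ C ∧ ‖gradient (u t) x‖ ≤ C)
    (hA : ∀ t ∈ Ioo (0 : ℝ) T, ∀ x, u t x ≤ A)
    {ε τ t : ℝ} (hε : 0 < ε) (hτ : 0 < τ) (ht : t ∈ Ioo τ T) (x : EuclideanSpace ℝ (Fin n)) :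
    (t - τ) / (1 + K * (t - τ)) * (deriv (fun s => u s x) t / (u t x + ε)) ≤
      m + 4 * (Real.log (A + ε) - Real.log (u t x + ε)) := by
  obtain ⟨Cφ, hCφ⟩ := hgradφ
  obtain ⟨α, hα0, hατ, hαK⟩ : ∃ α, 0 ≤ α ∧ α < τ ∧ K * (τ - α) < 1 := by
    refine ⟨max 0 (τ - 1 / (K + 1)), le_max_left _ _, max_lt hτ ?_, ?_⟩
    · have : 0 < 1 / (K + 1) := by positivity
      linarith
    · have h1 : τ - max 0 (τ - 1 / (K + 1)) ≤ 1 / (K + 1) := by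
        linarith [le_max_right 0 (τ - 1 / (K + 1))]
      refine (mul_le_mul_of_nonneg_left h1 hK).trans_lt ?_
      rw [mul_one_div, div_lt_one (by linarith)]
      linarith
  set U : ℝ × EuclideanSpace ℝ (Fin n) → ℝ := fun p => u p.1 p.2 with hU
  set V : ℝ × EuclideanSpace ℝ (Fin n) → ℝ := fun p => U p + ε with hV
  set Ω := Ioo α T ×ˢ (univ : Set (EuclideanSpace ℝ (Fin n))) with hΩdef
  have hΩ : IsOpen Ω := isOpen_Ioo.prod isOpen_univ
  have hmem {p : ℝ × EuclideanSpace ℝ (Fin n)} (hp : p ∈ Ω) : p.1 ∈ Ioo 0 T :=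
    ⟨hα0.trans_lt hp.1.1, hp.1.2⟩
  have hUsm : ContDiffOn ℝ (⊤ : ℕ∞) U Ω := hu.mono fun p hp => ⟨hmem hp, mem_univ _⟩
  have hVsm : ContDiffOn ℝ (⊤ : ℕ∞) V Ω := hUsm.add contDiffOn_const
  have hVε {p} (hp : p ∈ Ω) : ε < V p := by
    have := hpos p.1 (hmem hp) p.2
    simp only [hV, hU]
    linarith
  have hVpos : ∀ p ∈ Ω, 0 < V p := fun p hp => hε.trans (hVε hp)
  have hUd {p} (hp : p ∈ Ω) : DifferentiableAt ℝ U p := hUsm.differentiableAt_of_isOpen hΩ hp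
  have hVU (v) {p} (hp : p ∈ Ω) : dirDeriv v V p = dirDeriv v U p := by
    rw [hV, dirDeriv_add (hUd hp) (differentiableAt_const _), dirDeriv_const, add_zero]
  have hUt {p} (hp : p ∈ Ω) : dirDeriv (timeDir n) U p = deriv (fun s => u s p.2) p.1 :=
    (deriv_slice_eq_dirDeriv (g := u) (hUd hp)).symm
  have hUx (i : Fin n) {p} (hp : p ∈ Ω) :
      dirDeriv (spaceDir i) U p = fderiv ℝ (u p.1) p.2 (EuclideanSpace.single i 1) :=
    (fderiv_slice_eq_dirDeriv (g := u) (hUd hp) _).symm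
  have hUxx (i : Fin n) {p} (hp : p ∈ Ω) : dirDeriv (spaceDir i) (dirDeriv (spaceDir i) U) p =
      hess n (u p.1) p.2 (EuclideanSpace.single i 1) (EuclideanSpace.single i 1) := by
    have h1 := fderiv_slice_eq_dirDeriv (g := fun s y => dirDeriv (spaceDir i) U (s, y))
      (t := p.1) (x := p.2)
      ((contDiffOn_dirDeriv hΩ hUsm).differentiableAt_of_isOpen hΩ hp) (EuclideanSpace.single i 1)
    rw [hess]
    refine h1.symm.trans ?_
    congr 2
    funext y
    exact hUx i (p := (p.1, y)) ⟨hp.1, mem_univ _⟩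
  have hlogt (v) {p} (hp : p ∈ Ω) :
      dirDeriv v (fun q => Real.log (V q)) p = dirDeriv v U p / V p := by
    rw [dirDeriv_log hΩ hVsm hVpos hp, hVU v hp]
  have hlogxx (v) {p} (hp : p ∈ Ω) : dirDeriv v (dirDeriv v (fun q => Real.log (V q))) p =
      dirDeriv v (dirDeriv v U) p / V p - (dirDeriv v U p / V p) ^ 2 := by
    rw [dirDeriv_dirDeriv_log hΩ hVsm hVpos hp, hVU v hp,
      dirDeriv_congr hΩ (fun q hq => hVU v hq) hp]
  set b : Fin n → ℝ × EuclideanSpace ℝ (Fin n) → ℝ :=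
    fun i p => fderiv ℝ φ p.2 (EuclideanSpace.single i 1) with hb
  have hφ' (i : Fin n) :
      ContDiff ℝ (⊤ : ℕ∞) (fun y => fderiv ℝ φ y (EuclideanSpace.single i 1)) :=
    (hφ.fderiv_right (m := (⊤ : ℕ∞)) le_rfl).clm_apply contDiff_const
  have hbD (i : Fin n) (p v) : dirDeriv v (b i) p =
      fderiv ℝ (fun y => fderiv ℝ φ y (EuclideanSpace.single i 1)) p.2 v.2 :=
    dirDeriv_comp_snd (((hφ' i).differentiable (by simp)).differentiableAt) v
  have hquot {p} (hp : p ∈ Ω) {y : ℝ} (hy : |y| ≤ C) : |y / V p| ≤ C / ε := by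
    rw [abs_div, abs_of_pos (hVpos p hp)]
    exact div_le_div₀ ((abs_nonneg y).trans hy) hy hε (hVε hp).le
  have key := hamilton_estimate_log (B := max Cφ (C / ε)) (a := Real.log (A + ε)) hn hm hK hατ hαK
    (f := fun q => Real.log (V q)) (b := b) (hVsm.log fun p hp => (hVpos p hp).ne')
    (fun i => ((hφ' i).comp contDiff_snd).contDiffOn)
    (fun i p => by rw [hbD]; simp [timeDir])
    (fun p v => by
      simp only [hbD]
      exact hCD.coordinates hφ p.2 v)
    (fun p hp => by
      have h1 := hheat p.1 (hmem hp) p.2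
      rw [witten, lap, inner_gradient_eq_sum, ← hUt hp] at h1
      rw [hlogt _ hp, h1, ← Finset.sum_sub_distrib, Finset.sum_div]
      refine Finset.sum_congr rfl fun i _ => ?_
      rw [hlogxx _ hp, hlogt _ hp, hUxx i hp, hUx i hp]
      ring)
    (fun i p => ((abs_fderiv_single_le φ p.2 i).trans (hCφ p.2)).trans (le_max_left _ _))
    (fun i p hp => by
      rw [hlogt _ hp, hUx i hp]
      exact (hquot hp ((abs_fderiv_single_le _ _ i).trans (hbd p.1 (hmem hp) p.2).2)).trans
        (le_max_right _ _))
    (fun p hp => by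
      rw [hlogt _ hp, hUt hp]
      exact ((le_abs_self _).trans (hquot hp (hbd p.1 (hmem hp) p.2).1)).trans (le_max_right _ _))
    (fun p hp => Real.log_le_log (hVpos p hp) (by
      have := hA p.1 (hmem hp) p.2
      simp only [hV, hU]
      linarith))
    (q := (t, x)) ht
  have hqΩ : (t, x) ∈ Ω := ⟨⟨hατ.trans ht.1, ht.2⟩, mem_univ _⟩
  refine le_trans (mul_le_mul_of_nonneg_left ?_ ?_) key
  · rw [hlogt _ hqΩ, hUt hqΩ]
    exact le_add_of_nonneg_right (Finset.sum_nonneg fun i _ => mul_self_nonneg _)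
  · have h1 : 0 ≤ t - τ := sub_nonneg.2 ht.1.le
    positivity

lemma hamilton_estimate_interior
    (hn : 1 ≤ n) {m K T : ℝ} (hm : (n : ℝ) < m) (hK : 0 ≤ K)
    {φ : EuclideanSpace ℝ (Fin n) → ℝ} (hφ : ContDiff ℝ (⊤ : ℕ∞) φ)
    (hCD : CDcond n φ m K)
    (hgradφ : ∃ C, ∀ x, ‖gradient φ x‖ ≤ C)
    {u : ℝ → EuclideanSpace ℝ (Fin n) → ℝ}
    (hu : ContDiffOn ℝ (⊤ : ℕ∞) (fun p : ℝ × EuclideanSpace ℝ (Fin n) => u p.1 p.2)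
      (Ioo 0 T ×ˢ univ))
    (hpos : ∀ t ∈ Ioo (0 : ℝ) T, ∀ x, 0 < u t x)
    (hheat : ∀ t ∈ Ioo (0 : ℝ) T, ∀ x, deriv (fun s => u s x) t = witten n φ (u t) x)
    {C A : ℝ}
    (hbd : ∀ t ∈ Ioo (0 : ℝ) T, ∀ x,
      |deriv (fun s => u s x) t| ≤ C ∧ ‖gradient (u t) x‖ ≤ C)
    (hA : ∀ t ∈ Ioo (0 : ℝ) T, ∀ x, u t x ≤ A)
    {t : ℝ} (ht : t ∈ Ioo 0 T) (x : EuclideanSpace ℝ (Fin n)) :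
    deriv (fun s => u s x) t / u t x ≤ (K + 1 / t) * (m + 4 * Real.log (A / u t x)) := by
  have hut := hpos t ht x
  have hA0 : 0 < A := hut.trans_le (hA t ht x)
  have ht0 := ht.1
  have hσ : 0 < 1 + K * t := by positivity
  set D := deriv (fun s => u s x) t with hD
  have hlhs : ContinuousAt (fun s : ℝ => (t - s) / (1 + K * (t - s)) * (D / (u t x + s))) 0 := by
    refine ContinuousAt.mul (ContinuousAt.div (by fun_prop) (by fun_prop) (by simpa using hσ.ne'))
      (ContinuousAt.div (by fun_prop) (by fun_prop) (by simpa using hut.ne'))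
  have hrhs : ContinuousAt
      (fun s : ℝ => m + 4 * (Real.log (A + s) - Real.log (u t x + s))) 0 := by
    refine continuousAt_const.add (continuousAt_const.mul (ContinuousAt.sub ?_ ?_))
    · exact ContinuousAt.log (by fun_prop) (by simpa using hA0.ne')
    · exact ContinuousAt.log (by fun_prop) (by simpa using hut.ne')
  have hle := le_of_tendsto_of_tendsto (b := 𝓝[>] (0 : ℝ))
    (hlhs.tendsto.mono_left nhdsWithin_le_nhds)
    (hrhs.tendsto.mono_left nhdsWithin_le_nhds) (by
      filter_upwards [Ioo_mem_nhdsGT ht0] with s hs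
      exact hamilton_estimate_shifted hn hm hK hφ hCD hgradφ hu hpos hheat hbd hA hs.1 hs.1
        ⟨hs.2, ht.2⟩ x)
  simp only [sub_zero, add_zero] at hle
  rw [Real.log_div hA0.ne' hut.ne']
  have h1 : K + 1 / t = (t / (1 + K * t))⁻¹ := by
    field_simp
    ring
  rw [h1, inv_mul_eq_div, le_div_iff₀' (by positivity)]
  exact hle

end SpaceTime


/-- Hamilton's estimate, inequality (2.9): `∂ₜu/u ≤ (K + 1/t)(m + 4 log(A/u))`
for bounded positive solutions of the heat equation of the Witten Laplacian on `ℝⁿ`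
under the `CD(−K, m)` condition (Euclidean case of Theorem 2.3). -/
theorem hamilton_estimate_time_derivative_witten
    (n : ℕ) (hn : 1 ≤ n) (m K T : ℝ) (hm : (n : ℝ) < m) (hK : 0 ≤ K) (hT : 0 < T)
    (φ : EuclideanSpace ℝ (Fin n) → ℝ) (hφ : ContDiff ℝ (⊤ : ℕ∞) φ)
    (hCD : CDcond n φ m K)
    (hgradφ : ∃ C, ∀ x, ‖gradient φ x‖ ≤ C)
    (hhessφ : ∃ C, ∀ x v w, |hess n φ x v w| ≤ C * ‖v‖ * ‖w‖)
    (u : ℝ → EuclideanSpace ℝ (Fin n) → ℝ)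
    (hu : ContDiffOn ℝ (⊤ : ℕ∞) (fun p : ℝ × EuclideanSpace ℝ (Fin n) => u p.1 p.2)
      {p : ℝ × EuclideanSpace ℝ (Fin n) | p.1 ∈ Set.Icc 0 T})
    (hpos : ∀ t ∈ Set.Icc (0 : ℝ) T, ∀ x, 0 < u t x)
    (hheat : ∀ t ∈ Set.Icc (0 : ℝ) T, ∀ x, deriv (fun s => u s x) t = witten n φ (u t) x)
    (hbd : ∃ C, ∀ t ∈ Set.Icc (0 : ℝ) T, ∀ x,
      |u t x| ≤ C ∧ |deriv (fun s => u s x) t| ≤ C ∧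
        ‖gradient (u t) x‖ ≤ C ∧ hessNormSq n (u t) x ≤ C)
    (A : ℝ)
    (hA : IsLUB {a : ℝ | ∃ t ∈ Set.Icc (0 : ℝ) T, ∃ x, a = u t x} A) :
    ∀ t ∈ Set.Ioc (0 : ℝ) T, ∀ x,
      deriv (fun s => u s x) t / u t x
        ≤ (K + 1 / t) * (m + 4 * Real.log (A / u t x)) := by
  obtain ⟨C, hC⟩ := hbd
  have hA' : ∀ t ∈ Set.Icc (0 : ℝ) T, ∀ x, u t x ≤ A := fun t ht x => hA.1 ⟨t, ht, x, rfl⟩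
  have hinterior : ∀ t ∈ Set.Ioo (0 : ℝ) T, ∀ x, deriv (fun s => u s x) t / u t x
      ≤ (K + 1 / t) * (m + 4 * Real.log (A / u t x)) := fun t ht x =>
    hamilton_estimate_interior hn hm hK hφ hCD hgradφ
      (hu.mono fun p hp => Set.Ioo_subset_Icc_self hp.1)
      (fun t ht => hpos t (Set.Ioo_subset_Icc_self ht))
      (fun t ht => hheat t (Set.Ioo_subset_Icc_self ht)) (C := C)
      (fun t ht x =>
        have h := hC t (Set.Ioo_subset_Icc_self ht) x
        ⟨h.2.1, h.2.2.1⟩)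
      (fun t ht => hA' t (Set.Ioo_subset_Icc_self ht)) ht x
  intro t ht x
  rcases ht.2.lt_or_eq with htT | rfl
  · exact hinterior t ⟨ht.1, htT⟩ x
  have htI : t ∈ Set.Icc 0 t := ⟨hT.le, le_rfl⟩
  have hut := hpos t htI x
  have hA0 : 0 < A := hut.trans_le (hA' t htI x)
  have hm0 : 0 < m := lt_of_le_of_lt (Nat.cast_nonneg n) hm
  by_cases hd : DifferentiableAt ℝ (fun s => u s x) t
  · have hg : ContDiffOn ℝ (⊤ : ℕ∞) (fun s => u s x) (Set.Icc 0 t) :=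
      hu.comp (f := fun s : ℝ => (s, x)) (by fun_prop) fun s hs => hs
    have hud := uniqueDiffOn_Icc hT
    have hc1 := (hg.continuousOn_derivWithin hud (by simp)) t htI
    have hc0 := hg.continuousOn t htI
    rw [← hd.derivWithin (hud t htI)]
    have hsub := Set.Ioo_subset_Icc_self (a := 0) (b := t)
    have hlhs := ((hc1.div hc0 hut.ne').mono hsub).tendsto
    have hrhs : ContinuousWithinAt
        (fun s => (K + 1 / s) * (m + 4 * Real.log (A / u s x))) (Set.Icc 0 t) t := by
      refine ContinuousWithinAt.mul ?_ (continuousWithinAt_const.add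
        (continuousWithinAt_const.mul (ContinuousWithinAt.log ?_ (div_pos hA0 hut).ne')))
      · exact continuousWithinAt_const.add
          (continuousWithinAt_const.div continuousWithinAt_id hT.ne')
      · exact continuousWithinAt_const.div hc0 hut.ne'
    have := right_nhdsWithin_Ioo_neBot hT
    refine le_of_tendsto_of_tendsto hlhs (hrhs.mono hsub).tendsto ?_
    filter_upwards [self_mem_nhdsWithin] with s hs
    have hds : derivWithin (fun s => u s x) (Set.Icc 0 t) s = deriv (fun s => u s x) s :=
      derivWithin_of_mem_nhds (Icc_mem_nhds hs.1 hs.2)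
    simpa [hds] using hinterior s hs x
  · rw [deriv_zero_of_not_differentiableAt hd, zero_div]
    have : 0 ≤ Real.log (A / u t x) := Real.log_nonneg ((one_le_div hut).2 (hA' t htI x))
    positivity
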